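/- There is a first-order sentence, over a signature of binary relation symbols, that is preserved under taking generated subframes within the class of finite frames but is not equivalent over finite frames to any ∃-bounded first-order sentence. -/

import Mathlib

/-- A frame: a first-order structure over a signature consisting of
binary relation symbols indexed by `I`. -/
structure KFrame (I : Type) where
  W : Type
  R : I → W → W → Prop

/-- First-order formulas over a signature of binary relation symbols indexed
by `I`, with variables indexed by `ℕ`. -/
inductive FO (I : Type) : Type
  | eq : ℕ → ℕ → FO I
  | rel : I → ℕ → ℕ → FO I
  | fal : FO I
  | neg : FO I → FO I
  | and : FO I → FO I → FO I
  | or : FO I → FO I → FO I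
  | imp : FO I → FO I → FO I
  | ex : ℕ → FO I → FO I
  | all : ℕ → FO I → FO I

/-- Tarskian satisfaction of a first-order formula in a frame, relative to a
variable assignment `g`. -/
def FOSat {I : Type} (F : KFrame I) : (ℕ → F.W) → FO I → Prop
  | g, .eq x y => g x = g y
  | g, .rel i x y => F.R i (g x) (g y)
  | _, .fal => False
  | g, .neg φ => ¬ FOSat F g φ
  | g, .and φ ψ => FOSat F g φ ∧ FOSat F g ψ
  | g, .or φ ψ => FOSat F g φ ∨ FOSat F g ψ
  | g, .imp φ ψ => FOSat F g φ → FOSat F g ψ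
  | g, .ex x φ => ∃ d : F.W, FOSat F (Function.update g x d) φ
  | g, .all x φ => ∀ d : F.W, FOSat F (Function.update g x d) φ

/-- The free variables of a first-order formula. -/
def freeVars {I : Type} : FO I → Finset ℕ
  | .eq x y => {x, y}
  | .rel _ x y => {x, y}
  | .fal => ∅
  | .neg φ => freeVars φ
  | .and φ ψ => freeVars φ ∪ freeVars ψ
  | .or φ ψ => freeVars φ ∪ freeVars ψ
  | .imp φ ψ => freeVars φ ∪ freeVars ψ
  | .ex x φ => freeVars φ \ {x}
  | .all x φ => freeVars φ \ {x}

/-- Truth of a (closed) first-order formula in a frame. -/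
def FrameSat {I : Type} (F : KFrame I) (φ : FO I) : Prop :=
  ∀ g : ℕ → F.W, FOSat F g φ

/-- ∃-bounded first-order formulas: built up from literals (including equality
literals) using conjunction, disjunction, bounded quantification of the forms
`∃x(R(y,x) ∧ …)` and `∀x(R(y,x) → …)` (with `y` distinct from `x`), and,
additionally, unrestricted universal quantification. -/
inductive ExBounded {I : Type} : FO I → Prop
  | eq (x y : ℕ) : ExBounded (.eq x y)
  | neq (x y : ℕ) : ExBounded (.neg (.eq x y))
  | rel (i : I) (x y : ℕ) : ExBounded (.rel i x y)
  | nrel (i : I) (x y : ℕ) : ExBounded (.neg (.rel i x y))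
  | and {φ ψ : FO I} : ExBounded φ → ExBounded ψ → ExBounded (.and φ ψ)
  | or {φ ψ : FO I} : ExBounded φ → ExBounded ψ → ExBounded (.or φ ψ)
  | bex (i : I) (y x : ℕ) {φ : FO I} :
      x ≠ y → ExBounded φ → ExBounded (.ex x (.and (.rel i y x) φ))
  | ball (i : I) (y x : ℕ) {φ : FO I} :
      x ≠ y → ExBounded φ → ExBounded (.all x (.imp (.rel i y x) φ))
  | uall (x : ℕ) {φ : FO I} : ExBounded φ → ExBounded (.all x φ)

/-- `X` is closed under the relations of `G` (i.e. the restriction of `G` to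
`X` is a generated subframe of `G`). -/
def RClosed {I : Type} (G : KFrame I) (X : Set G.W) : Prop :=
  ∀ (i : I) (w v : G.W), w ∈ X → G.R i w v → v ∈ X

/-- The restriction of a frame to a subset of its domain. -/
def KFrame.restrict {I : Type} (G : KFrame I) (X : Set G.W) : KFrame I :=
  ⟨X, fun i u v => G.R i u.1 v.1⟩

/-- Any two reflexive points (for relation `0`) are related by relation `0`. -/
def ReflTotal (G : KFrame (Fin 4)) : Prop :=
  ∀ x y, G.R 0 x x → G.R 0 y y → G.R 0 x y

/-- There is a reflexive point, and, reading relation `1` as membership, the sets of reflexive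
points coded by elements of the frame include the empty set and are closed under inserting a
reflexive point. -/
def CodesSubsets (G : KFrame (Fin 4)) : Prop :=
  (∃ x, G.R 0 x x) ∧ (∃ r, ∀ q, G.R 0 q q → ¬ G.R 1 r q) ∧
    ∀ r p, G.R 0 p p → ∃ r', ∀ q, G.R 0 q q → (G.R 1 r' q ↔ G.R 1 r q ∨ q = p)

/-- First-order sentence expressing `ReflTotal`. -/
def reflTotalSentence : FO (Fin 4) :=
  .all 0 (.all 1 (.imp (.rel 0 0 0) (.imp (.rel 0 1 1) (.rel 0 0 1))))

/-- First-order sentence expressing `CodesSubsets`. -/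
def codesSubsetsSentence : FO (Fin 4) :=
  .and (.ex 0 (.rel 0 0 0))
    (.and (.ex 0 (.all 1 (.imp (.rel 0 1 1) (.neg (.rel 1 0 1)))))
      (.all 0 (.all 1 (.imp (.rel 0 1 1) (.ex 2 (.all 3 (.imp (.rel 0 3 3)
        (.and (.imp (.rel 1 2 3) (.or (.rel 1 0 3) (.eq 3 1)))
          (.imp (.or (.rel 1 0 3) (.eq 3 1)) (.rel 1 2 3))))))))))

/-- The sentence witnessing the failure of the preservation theorem. -/
def missingSubsetSentence : FO (Fin 4) :=
  .and reflTotalSentence (.neg codesSubsetsSentence)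

lemma foSat_missingSubsetSentence (G : KFrame (Fin 4)) (g : ℕ → G.W) :
    FOSat G g missingSubsetSentence ↔ ReflTotal G ∧ ¬ CodesSubsets G := by
  simp [missingSubsetSentence, reflTotalSentence, codesSubsetsSentence, FOSat, ReflTotal,
    CodesSubsets, iff_iff_implies_and_implies]

lemma CodesSubsets.exists_code {G : KFrame (Fin 4)} [Finite G.W] (h : CodesSubsets G)
    (S : Set G.W) (hS : ∀ q ∈ S, G.R 0 q q) :
    ∃ r, ∀ q, G.R 0 q q → (G.R 1 r q ↔ q ∈ S) := by
  induction S, S.toFinite using Set.Finite.induction_on with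
  | empty =>
    obtain ⟨r, hr⟩ := h.2.1
    exact ⟨r, fun q hq => by simpa using hr q hq⟩
  | @insert a S _ _ ih =>
    obtain ⟨r, hr⟩ := ih fun q hq => hS q (Set.mem_insert_of_mem a hq)
    obtain ⟨r', hr'⟩ := h.2.2 r a (hS a (Set.mem_insert a S))
    refine ⟨r', fun q hq => ?_⟩
    rw [hr' q hq, hr q hq, Set.mem_insert_iff, or_comm]

lemma ReflTotal.restrict {G : KFrame (Fin 4)} (h : ReflTotal G) (X : Set G.W) :
    ReflTotal (G.restrict X) :=
  fun x y => h x.1 y.1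

lemma CodesSubsets.of_restrict {G : KFrame (Fin 4)} [Finite G.W] {X : Set G.W}
    (hX : RClosed G X) (hG : ReflTotal G) (h : CodesSubsets (G.restrict X)) :
    CodesSubsets G := by
  have : Finite (G.restrict X).W := inferInstanceAs (Finite X)
  obtain ⟨⟨a, ha⟩, -⟩ := id h
  have hbase : ∀ q, G.R 0 q q → q ∈ X := fun q hq => hX 0 a.1 q a.2 (hG _ _ ha hq)
  have hcode : ∀ S : Set G.W, ∃ r, ∀ q, G.R 0 q q → (G.R 1 r q ↔ q ∈ S) := by
    intro S
    obtain ⟨r, hr⟩ := h.exists_code {q | q.1 ∈ S ∧ G.R 0 q.1 q.1} fun q hq => hq.2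
    refine ⟨r.1, fun q hq => ?_⟩
    exact (hr ⟨q, hbase q hq⟩ hq).trans (and_iff_left hq)
  refine ⟨⟨a.1, ha⟩, ?_, fun r p _ => ?_⟩
  · obtain ⟨r, hr⟩ := hcode ∅
    exact ⟨r, fun q hq => by simp [hr q hq]⟩
  · obtain ⟨r', hr'⟩ := hcode {q | G.R 1 r q ∨ q = p}
    exact ⟨r', fun q hq => hr' q hq⟩

/-- Satisfaction depends only on the values of the free variables. -/
lemma foSat_congr {I : Type} (F : KFrame I) (φ : FO I) :
    ∀ g g' : ℕ → F.W, (∀ i ∈ freeVars φ, g i = g' i) → (FOSat F g φ ↔ FOSat F g' φ) := by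
  have hupd : ∀ (ψ : FO I) (x : ℕ) (g g' : ℕ → F.W) (d : F.W),
      (∀ i ∈ freeVars ψ \ {x}, g i = g' i) →
        ∀ i ∈ freeVars ψ, Function.update g x d i = Function.update g' x d i := by
    intro ψ x g g' d h i hi
    by_cases hix : i = x
    · simp [hix]
    · simpa [Function.update_of_ne hix] using h i (by simp [hi, hix])
  induction φ with
  | eq x y => intro g g' h; simp [FOSat, h x (by simp [freeVars]), h y (by simp [freeVars])]
  | rel i x y => intro g g' h; simp [FOSat, h x (by simp [freeVars]), h y (by simp [freeVars])]
  | fal => intro g g' _; rfl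
  | neg φ ih => intro g g' h; exact not_congr (ih g g' h)
  | and φ ψ ih₁ ih₂ =>
    intro g g' h
    exact and_congr (ih₁ g g' fun i hi => h i (Finset.mem_union_left _ hi))
      (ih₂ g g' fun i hi => h i (Finset.mem_union_right _ hi))
  | or φ ψ ih₁ ih₂ =>
    intro g g' h
    exact or_congr (ih₁ g g' fun i hi => h i (Finset.mem_union_left _ hi))
      (ih₂ g g' fun i hi => h i (Finset.mem_union_right _ hi))
  | imp φ ψ ih₁ ih₂ =>
    intro g g' h
    exact imp_congr (ih₁ g g' fun i hi => h i (Finset.mem_union_left _ hi))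
      (ih₂ g g' fun i hi => h i (Finset.mem_union_right _ hi))
  | ex x φ ih => intro g g' h; exact exists_congr fun d => ih _ _ (hupd φ x g g' d h)
  | all x φ ih => intro g g' h; exact forall_congr' fun d => ih _ _ (hupd φ x g g' d h)

/-- The frame with a set `X` of points, all related by relation `0`, and a family `𝓕` of subsets
of `X`, related to their elements by relation `1`. -/
def setFrame {X : Type} (𝓕 : Set (Set X)) : KFrame (Fin 4) where
  W := X ⊕ 𝓕
  R i u v := match u, v with
    | .inl _, .inl _ => i = 0
    | .inr S, .inl x => i = 1 ∧ x ∈ S.1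
    | _, .inr _ => False

section SetFrame

variable {X : Type} {𝓕 𝓖 : Set (Set X)}

lemma setFrame_reflTotal : ReflTotal (setFrame 𝓕) := by
  rintro (x | S) (y | T) <;> simp [setFrame]

lemma setFrame_univ_codesSubsets [Nonempty X] :
    CodesSubsets (setFrame (Set.univ : Set (Set X))) := by
  obtain ⟨x₀⟩ := ‹Nonempty X›
  refine ⟨⟨.inl x₀, rfl⟩, ⟨.inr ⟨∅, trivial⟩, ?_⟩, ?_⟩
  · rintro (q | S) <;> simp [setFrame]
  · rintro r (p | P) hp
    · refine ⟨.inr ⟨{q | (setFrame Set.univ).R 1 r (.inl q) ∨ q = p}, trivial⟩, ?_⟩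
      rintro (q | Q) hq
      · simp [setFrame]
      · exact hq.elim
    · exact hp.elim

lemma mem_of_setFrame_codesSubsets [Finite X] (h : CodesSubsets (setFrame 𝓕)) {S : Set X}
    (hS : S.Nonempty) : S ∈ 𝓕 := by
  have : Finite (setFrame 𝓕).W := inferInstanceAs (Finite (X ⊕ 𝓕))
  obtain ⟨r, hr⟩ := h.exists_code (Set.image Sum.inl S) (by rintro _ ⟨x, -, rfl⟩; rfl)
  have hr' : ∀ x : X, (setFrame 𝓕).R 1 r (.inl x) ↔ x ∈ S := fun x =>
    (hr (.inl x) rfl).trans (Sum.inl_injective.mem_set_image (a := x))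
  rcases r with y | T
  · obtain ⟨x, hx⟩ := hS
    simpa [setFrame] using (hr' x).2 hx
  · have : T.1 = S := Set.ext fun x => by simpa [setFrame] using hr' x
    exact this ▸ T.2

/-- The two elements correspond to each other under the bijection `f` of the points. -/
def Corr (f : X ≃ X) : (setFrame 𝓕).W → (setFrame 𝓖).W → Prop
  | .inl x, .inl y => f x = y
  | .inr S, .inr T => ∀ x, x ∈ S.1 ↔ f x ∈ T.1
  | _, _ => False

lemma Corr.rel_iff {f : X ≃ X} {u v : (setFrame 𝓕).W} {u' v' : (setFrame 𝓖).W}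
    (hu : Corr f u u') (hv : Corr f v v') (i : Fin 4) :
    (setFrame 𝓕).R i u v ↔ (setFrame 𝓖).R i u' v' := by
  rcases u with x | S <;> rcases u' with x' | S' <;> rcases v with y | T <;>
    rcases v' with y' | T' <;> simp_all [Corr, setFrame]

lemma Corr.eq_iff {f : X ≃ X} {u v : (setFrame 𝓕).W} {u' v' : (setFrame 𝓖).W}
    (hu : Corr f u u') (hv : Corr f v v') : u = v ↔ u' = v' := by
  rcases u with x | S <;> rcases u' with x' | S' <;> try exact hu.elim
  all_goals rcases v with y | T <;> rcases v' with y' | T' <;> try exact hv.elim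
  · simp only [Corr] at hu hv
    subst hu hv
    exact ⟨fun h => by cases h; rfl, fun h => by rw [f.injective (Sum.inl.inj h)]⟩
  · exact iff_of_false (fun h => by cases h) (fun h => by cases h)
  · exact iff_of_false (fun h => by cases h) (fun h => by cases h)
  · simp only [Corr] at hu hv
    constructor <;> intro h <;> obtain rfl := Sum.inr.inj h <;> congr 1 <;> ext x
    · simpa using (hu (f.symm x)).symm.trans (hv (f.symm x))
    · exact (hu x).trans (hv x).symm

/-- The element does not distinguish the points of `C`. -/
def Homogeneous (C : Finset X) : (setFrame 𝓕).W → Prop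
  | .inl x => x ∉ C
  | .inr S => (∀ x ∈ C, x ∈ S.1) ∨ ∀ x ∈ C, x ∉ S.1

lemma Homogeneous.mono {C D : Finset X} (hDC : D ⊆ C) {u : (setFrame 𝓕).W}
    (h : Homogeneous C u) : Homogeneous D u := by
  rcases u with x | S
  · exact fun hx => h (hDC hx)
  · exact h.imp (fun h x hx => h x (hDC hx)) (fun h x hx => h x (hDC hx))

lemma Corr.trans_perm {f : X ≃ X} {C : Finset X} {σ : Equiv.Perm X}
    (hσ : ∀ x, x ∉ C → σ x = x) (hσC : ∀ x ∈ C, σ x ∈ C)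
    {u : (setFrame 𝓕).W} {u' : (setFrame 𝓖).W} (h : Corr f u u') (hu : Homogeneous C u) :
    Corr (σ.trans f) u u' := by
  rcases u with x | S <;> rcases u' with x' | S' <;> try exact h.elim
  · simpa [Corr, hσ x hu] using h
  · intro x
    refine Iff.trans ?_ (h (σ x))
    by_cases hx : x ∈ C
    · rcases hu with hu | hu
      · exact iff_of_true (hu x hx) (hu _ (hσC x hx))
      · exact iff_of_false (hu x hx) (hu _ (hσC x hx))
    · rw [hσ x hx]

/-- A permutation moving one subset of `C` onto another of the same size, fixing the
complement of `C`. -/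
lemma exists_perm_image_eq [DecidableEq X] {C D E : Finset X} (hD : D ⊆ C) (hE : E ⊆ C)
    (hcard : D.card = E.card) :
    ∃ σ : Equiv.Perm X, (∀ x, x ∉ C → σ x = x) ∧ (∀ x ∈ C, σ x ∈ C) ∧ D.image σ = E := by
  classical
  let e : {x : C // x.1 ∈ D} ≃ {x : C // x.1 ∈ E} :=
    (Equiv.subtypeSubtypeEquivSubtype fun h => hD h).trans
      ((Finset.equivOfCardEq hcard).trans
        (Equiv.subtypeSubtypeEquivSubtype fun h => hE h).symm)
  let τ : Equiv.Perm C := e.extendSubtype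
  have hval : ∀ x (hx : x ∈ C), Equiv.Perm.ofSubtype τ x = τ ⟨x, hx⟩ :=
    fun x hx => Equiv.Perm.ofSubtype_apply_of_mem τ hx
  refine ⟨Equiv.Perm.ofSubtype τ, fun x hx => Equiv.Perm.ofSubtype_apply_of_not_mem τ hx,
    fun x hx => by rw [hval x hx]; exact (τ ⟨x, hx⟩).2, ?_⟩
  refine Finset.eq_of_subset_of_card_le (fun y hy => ?_) ?_
  · obtain ⟨x, hx, rfl⟩ := Finset.mem_image.1 hy
    rw [hval x (hD hx)]
    exact e.extendSubtype_mem ⟨x, hD hx⟩ hx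
  · rw [Finset.card_image_of_injective _ (Equiv.injective _), hcard]

/-- The invariant maintained in the comparison game: the assignments correspond under a
bijection `f`, and there is an undistinguished set `C` of points whose image has at least `k`
points inside and `k` points outside `M`. -/
def Invariant (M : Set X) (k : ℕ) (g : ℕ → (setFrame 𝓕).W) (g' : ℕ → (setFrame 𝓖).W) : Prop :=
  ∃ (f : X ≃ X) (C P Q : Finset X), (∀ i, Corr f (g i) (g' i)) ∧ (∀ i, Homogeneous C (g i)) ∧
    P ⊆ C ∧ Q ⊆ C ∧ (∀ x ∈ P, f x ∈ M) ∧ (∀ x ∈ Q, f x ∉ M) ∧ k ≤ P.card ∧ k ≤ Q.card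

lemma forall_update {α β : Type} {r : α → β → Prop} {g : ℕ → α} {g' : ℕ → β}
    (h : ∀ i, r (g i) (g' i)) (n : ℕ) {d : α} {d' : β} (hd : r d d') (i : ℕ) :
    r (Function.update g n d i) (Function.update g' n d' i) := by
  by_cases hi : i = n
  · subst hi; simpa using hd
  · simpa [hi] using h i

variable {M : Set X} {k l : ℕ} {g : ℕ → (setFrame 𝓕).W} {g' : ℕ → (setFrame 𝓖).W}

lemma Invariant.mono (hlk : l ≤ k) (h : Invariant M k g g') : Invariant M l g g' := by
  obtain ⟨f, C, P, Q, h₁, h₂, h₃, h₄, h₅, h₆, hP, hQ⟩ := h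
  exact ⟨f, C, P, Q, h₁, h₂, h₃, h₄, h₅, h₆, hlk.trans hP, hlk.trans hQ⟩

/-- A pair of points corresponding under a fixed bijection can be appended to both
assignments. -/
lemma Invariant.exists_equiv (h : Invariant M (k + 1) g g') (n : ℕ) :
    ∃ f : X ≃ X, ∀ x, Invariant M k (Function.update g n (.inl x))
      (Function.update g' n (.inl (f x))) := by
  classical
  obtain ⟨f, C, P, Q, hf, hC, hPC, hQC, hPM, hQM, hP, hQ⟩ := h
  refine ⟨f, fun x => ⟨f, C.erase x, P.erase x, Q.erase x, ?_, ?_, Finset.erase_subset_erase x hPC,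
    Finset.erase_subset_erase x hQC, fun y hy => hPM y (Finset.mem_of_mem_erase hy),
    fun y hy => hQM y (Finset.mem_of_mem_erase hy), ?_, ?_⟩⟩
  · exact forall_update hf n rfl
  · exact forall_update (r := fun u (_ : Unit) => Homogeneous (C.erase x) u) (g' := fun _ => ())
      (fun i => (hC i).mono (Finset.erase_subset x C)) n (d' := ()) (Finset.notMem_erase x C)
  · have := Finset.pred_card_le_card_erase (s := P) (a := x); omega
  · have := Finset.pred_card_le_card_erase (s := Q) (a := x); omega

/-- Every set on the left can be answered by a set other than `M` on the right. -/
lemma Invariant.exists_set {g' : ℕ → (setFrame ({M}ᶜ : Set (Set X))).W} (hk : 0 < k)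
    (h : Invariant M (2 * k) g g') (n : ℕ) (S : 𝓕) :
    ∃ d', Invariant M k (Function.update g n (.inr S)) (Function.update g' n d') := by
  classical
  obtain ⟨f, C, P, Q, hf, hC, hPC, hQC, hPM, hQM, hP, hQ⟩ := h
  have hPQ : Disjoint P Q := Finset.disjoint_left.2 fun x hxP hxQ => hQM x hxQ (hPM x hxP)
  have hcardC : 4 * k ≤ C.card := by
    have := Finset.card_le_card (Finset.union_subset hPC hQC)
    rw [Finset.card_union_of_disjoint hPQ] at this
    omega
  obtain ⟨P', hP', hP'k⟩ := Finset.exists_subset_card_eq (show k ≤ P.card by omega)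
  obtain ⟨Q', hQ', hQ'k⟩ := Finset.exists_subset_card_eq (show k ≤ Q.card by omega)
  have hPQ' : (P' ∪ Q').card = 2 * k := by
    rw [Finset.card_union_of_disjoint (hPQ.mono hP' hQ')]; omega
  obtain ⟨D, hDC, hDk, hDS⟩ : ∃ D ⊆ C, D.card = 2 * k ∧
      ((∀ x ∈ D, x ∈ S.1) ∨ ∀ x ∈ D, x ∉ S.1) := by
    have hsplit := Finset.card_filter_add_card_filter_not (s := C) (fun x => x ∈ S.1)
    rcases le_total (2 * k) (C.filter fun x => x ∈ S.1).card with hle | hle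
    · obtain ⟨D, hD, hDk⟩ := Finset.exists_subset_card_eq hle
      exact ⟨D, hD.trans (Finset.filter_subset _ _), hDk,
        .inl fun x hx => (Finset.mem_filter.1 (hD hx)).2⟩
    · obtain ⟨D, hD, hDk⟩ := Finset.exists_subset_card_eq
        (show 2 * k ≤ (C.filter fun x => x ∉ S.1).card by omega)
      exact ⟨D, hD.trans (Finset.filter_subset _ _), hDk,
        .inr fun x hx => (Finset.mem_filter.1 (hD hx)).2⟩
  obtain ⟨σ, hσ, hσC, hσD⟩ := exists_perm_image_eq hDC
    (Finset.union_subset (hP'.trans hPC) (hQ'.trans hQC)) (hDk.trans hPQ'.symm)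
  have hsymm : ∀ y, y ∈ P' ∪ Q' → σ.symm y ∈ D := by
    intro y hy
    rw [← hσD] at hy
    obtain ⟨x, hx, rfl⟩ := Finset.mem_image.1 hy
    simpa using hx
  have hne : Set.image f (Set.image σ S.1) ≠ M := by
    intro hM
    rcases hDS with hDS | hDS
    · obtain ⟨y, hy⟩ := Finset.card_pos.1 (hQ'k ▸ hk)
      refine hQM y (hQ' hy) (hM ▸ ⟨y, ⟨σ.symm y, hDS _ (hsymm y ?_), by simp⟩, rfl⟩)
      exact Finset.mem_union_right _ hy
    · obtain ⟨y, hy⟩ := Finset.card_pos.1 (hP'k ▸ hk)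
      have hyM := hPM y (hP' hy)
      rw [← hM] at hyM
      obtain ⟨_, ⟨x, hx, rfl⟩, hxy⟩ := hyM
      have hσx : σ x = y := f.injective hxy
      refine hDS x ?_ hx
      have := hsymm y (Finset.mem_union_left _ hy)
      rwa [← hσx, Equiv.symm_apply_apply] at this
  refine ⟨.inr ⟨Set.image f (Set.image σ S.1), hne⟩, σ.trans f, D,
    P'.image σ.symm, Q'.image σ.symm,
    ?_, ?_, ?_, ?_, ?_, ?_, ?_, ?_⟩
  · refine forall_update (fun i => (hf i).trans_perm hσ hσC (hC i)) n ?_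
    intro x
    simp
  · exact forall_update (r := fun u (_ : Unit) => Homogeneous D u) (g' := fun _ => ())
      (fun i => (hC i).mono hDC) n (d' := ()) hDS
  · exact Finset.image_subset_iff.2 fun y hy => hsymm y (Finset.mem_union_left _ hy)
  · exact Finset.image_subset_iff.2 fun y hy => hsymm y (Finset.mem_union_right _ hy)
  · intro x hx
    obtain ⟨y, hy, rfl⟩ := Finset.mem_image.1 hx
    simpa using hPM y (hP' hy)
  · intro x hx
    obtain ⟨y, hy, rfl⟩ := Finset.mem_image.1 hx
    simpa using hQM y (hQ' hy)
  · rw [Finset.card_image_of_injective _ σ.symm.injective, hP'k]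
  · rw [Finset.card_image_of_injective _ σ.symm.injective, hQ'k]

/-- The quantifier depth of a formula. -/
def quantifierDepth {I : Type} : FO I → ℕ
  | .eq _ _ => 0
  | .rel _ _ _ => 0
  | .fal => 0
  | .neg φ => quantifierDepth φ
  | .and φ ψ => max (quantifierDepth φ) (quantifierDepth ψ)
  | .or φ ψ => max (quantifierDepth φ) (quantifierDepth ψ)
  | .imp φ ψ => max (quantifierDepth φ) (quantifierDepth ψ)
  | .ex _ φ => quantifierDepth φ + 1
  | .all _ φ => quantifierDepth φ + 1

lemma setFrame_rel_eq_inl {i : Fin 4} {u v : (setFrame 𝓕).W} (h : (setFrame 𝓕).R i u v) :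
    ∃ x, v = .inl x := by
  rcases v with x | S
  · exact ⟨x, rfl⟩
  · rcases u with y | T <;> exact h.elim

/-- Under the invariant, `∃`-bounded formulas transfer from the frame omitting `M`. -/
lemma ExBounded.foSat_of_invariant {φ : FO (Fin 4)} (hφ : ExBounded φ) :
    ∀ (g : ℕ → (setFrame 𝓕).W) (g' : ℕ → (setFrame ({M}ᶜ : Set (Set X))).W),
      Invariant M (2 ^ quantifierDepth φ) g g' → FOSat _ g' φ → FOSat _ g φ := by
  have hpow : ∀ m : ℕ, 2 ^ m + 1 ≤ 2 ^ (m + 1) := fun m => by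
    have := Nat.one_le_two_pow (n := m); omega
  induction hφ with
  | eq x y =>
    rintro g g' ⟨f, C, P, Q, hf, -⟩ h
    exact ((hf x).eq_iff (hf y)).2 h
  | neq x y =>
    rintro g g' ⟨f, C, P, Q, hf, -⟩ h
    exact fun h' => h (((hf x).eq_iff (hf y)).1 h')
  | rel i x y =>
    rintro g g' ⟨f, C, P, Q, hf, -⟩ h
    exact ((hf x).rel_iff (hf y) i).2 h
  | nrel i x y =>
    rintro g g' ⟨f, C, P, Q, hf, -⟩ h
    exact fun h' => h (((hf x).rel_iff (hf y) i).1 h')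
  | and _ _ ih₁ ih₂ =>
    intro g g' hI h
    exact ⟨ih₁ g g' (hI.mono (Nat.pow_le_pow_right two_pos (le_max_left _ _))) h.1,
      ih₂ g g' (hI.mono (Nat.pow_le_pow_right two_pos (le_max_right _ _))) h.2⟩
  | or _ _ ih₁ ih₂ =>
    intro g g' hI h
    exact h.imp (ih₁ g g' (hI.mono (Nat.pow_le_pow_right two_pos (le_max_left _ _))))
      (ih₂ g g' (hI.mono (Nat.pow_le_pow_right two_pos (le_max_right _ _))))
  | @bex i y x φ hxy _ ih =>
    rintro g g' hI ⟨d, hd, hφd⟩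
    obtain ⟨q, rfl⟩ : ∃ q, d = .inl q := setFrame_rel_eq_inl (by simpa [FOSat] using hd)
    simp only [quantifierDepth, zero_le, max_eq_right] at hI
    obtain ⟨f, hf⟩ := (hI.mono (hpow _)).exists_equiv x
    have hfq := hf (f.symm q)
    rw [Equiv.apply_symm_apply] at hfq
    refine ⟨.inl (f.symm q), ?_, ih _ _ hfq hφd⟩
    obtain ⟨e, C, P, Q, he, -⟩ := hfq
    exact ((he y).rel_iff (he x) i).2 hd
  | @ball i y x φ hxy _ ih =>
    intro g g' hI h d hd
    obtain ⟨p, rfl⟩ : ∃ p, d = .inl p := setFrame_rel_eq_inl (by simpa [FOSat] using hd)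
    simp only [quantifierDepth, zero_le, max_eq_right] at hI
    obtain ⟨f, hf⟩ := (hI.mono (hpow _)).exists_equiv x
    refine ih _ _ (hf p) (h (.inl (f p)) ?_)
    obtain ⟨e, C, P, Q, he, -⟩ := hf p
    exact ((he y).rel_iff (he x) i).1 hd
  | @uall x φ _ ih =>
    rintro g g' hI h (p | S)
    · obtain ⟨f, hf⟩ := (hI.mono (hpow _)).exists_equiv x
      exact ih _ _ (hf p) (h _)
    · rw [quantifierDepth, pow_succ'] at hI
      obtain ⟨d', hd'⟩ := hI.exists_set (Nat.two_pow_pos _) x S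
      exact ih _ _ hd' (h d')

end SetFrame

/-- Theorem 3.4: there is a first-order sentence (over a signature of binary
relation symbols) that is preserved under taking generated subframes within
the class of finite frames, but that is not equivalent over finite frames to
any ∃-bounded first-order sentence. -/
theorem generated_subframe_preservation_fails_in_finite :
    ∃ θ : FO (Fin 4), freeVars θ = ∅ ∧
      (∀ (G : KFrame (Fin 4)), Finite G.W → ∀ X : Set G.W, RClosed G X →
        FrameSat G θ → FrameSat (G.restrict X) θ) ∧
      ¬ ∃ θ' : FO (Fin 4), ExBounded θ' ∧ freeVars θ' = ∅ ∧
          ∀ F : KFrame (Fin 4), Finite F.W → (FrameSat F θ ↔ FrameSat F θ') := by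
  refine ⟨missingSubsetSentence, by decide, ?_, ?_⟩
  · intro G hG X hX hθ g
    obtain ⟨hT, hF⟩ := (foSat_missingSubsetSentence G _).1 (hθ fun i => (g i).1)
    exact (foSat_missingSubsetSentence _ g).2 ⟨hT.restrict X, fun h => hF (h.of_restrict hX hT)⟩
  · rintro ⟨θ', hb, hfree, heq⟩
    let k := 2 ^ quantifierDepth θ'
    let X := Bool × Fin (k + 1)
    let M : Set X := {x | x.1 = true}
    let A := setFrame (Set.univ : Set (Set X))
    let B := setFrame ({M}ᶜ : Set (Set X))
    let p : X := (true, 0)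
    have : Finite A.W := inferInstanceAs (Finite (X ⊕ (Set.univ : Set (Set X))))
    have : Finite B.W := inferInstanceAs (Finite (X ⊕ ({M}ᶜ : Set (Set X))))
    have hB : FrameSat B θ' := (heq B inferInstance).1 fun g =>
      (foSat_missingSubsetSentence B g).2 ⟨setFrame_reflTotal, fun h =>
        mem_of_setFrame_codesSubsets h (S := M) ⟨p, rfl⟩ rfl⟩
    have hinv : Invariant (𝓕 := Set.univ) (𝓖 := {M}ᶜ) M k (fun _ => .inl p) (fun _ => .inl p) := by
      refine ⟨Equiv.refl X, Finset.univ.erase p,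
        Finset.univ.image fun j : Fin k => (true, j.succ),
        Finset.univ.image fun j : Fin k => (false, j.succ), fun _ => rfl,
        fun _ => Finset.notMem_erase _ _, ?_, ?_, ?_, ?_, ?_, ?_⟩
      · intro x hx
        obtain ⟨j, -, rfl⟩ := Finset.mem_image.1 hx
        exact Finset.mem_erase.2 ⟨fun h => Fin.succ_ne_zero j (congrArg Prod.snd h),
          Finset.mem_univ _⟩
      · intro x hx
        obtain ⟨j, -, rfl⟩ := Finset.mem_image.1 hx
        exact Finset.mem_erase.2 ⟨fun h => Fin.succ_ne_zero j (congrArg Prod.snd h),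
          Finset.mem_univ _⟩
      · simp [M]
      · simp [M]
      · rw [Finset.card_image_of_injective _ fun i j h =>
          Fin.succ_injective k (congrArg Prod.snd h), Finset.card_fin]
      · rw [Finset.card_image_of_injective _ fun i j h =>
          Fin.succ_injective k (congrArg Prod.snd h), Finset.card_fin]
    have hA : FrameSat A θ' := fun g =>
      (foSat_congr A θ' g _ (by simp [hfree])).2 (hb.foSat_of_invariant _ _ hinv (hB _))
    exact ((foSat_missingSubsetSentence A fun _ => .inl p).1
      ((heq A inferInstance).2 hA _)).2 setFrame_univ_codesSubsets
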